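/- arXiv:2010.12629 — 4 statements merged into one kernel-verified Lean document; each statement's English description precedes it below -/
import Mathlib

section
/- Let d ≥ 0 and let q : {0,1}^n → ℝ agree on {0,1}^n with a real multivariate polynomial of degree at most d, with |q(x)| ≤ 1 for all x ∈ {0,1}^n. Let V be any 2^n × 2^n real matrix satisfying V_{xy} = |x| − |y| for all x, y with ||x| − |y|| ≤ d. Then ‖B_q‖ ≤ γ₂(V). -/
noncomputable def specNorm {I : Type*} [Fintype I] [DecidableEq I] (A : Matrix I I ℝ) : ℝ :=
  ‖Matrix.toEuclideanCLM (𝕜 := ℝ) A‖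

/-- Adjacency matrix of the sensitivity graph of `f`. -/
def sensAdj {I : Type*} [Fintype I] [DecidableEq I] (f : (I → Bool) → Bool) :
    Matrix (I → Bool) (I → Bool) ℝ :=
  Matrix.of fun x y => if hammingDist x y = 1 ∧ f x ≠ f y then (1 : ℝ) else 0

/-- Spectral sensitivity `λ(f)`: the ℓ2→ℓ2 operator norm of the adjacency matrix of the
sensitivity graph of `f`. -/
noncomputable def specSens {I : Type*} [Fintype I] [DecidableEq I] (f : (I → Bool) → Bool) : ℝ :=
  specNorm (sensAdj f)

/-- Hamming weight of `x ∈ {0,1}^n`. -/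
def wt {n : ℕ} (x : Fin n → Bool) : ℕ := (Finset.univ.filter fun i => x i).card

/-- The `2^n × 2^n` Hadamard matrix: `H x y = (-1)^⟨x,y⟩ · 2^{-n/2}`. -/
noncomputable def Hmat (n : ℕ) : Matrix (Fin n → Bool) (Fin n → Bool) ℝ :=
  Matrix.of fun x y =>
    (-1 : ℝ) ^ ((Finset.univ.filter fun i => x i ∧ y i).card) / Real.sqrt (2 ^ n)

/-- The diagonal matrix `X` with `X x x = |x|` (Hamming weight). -/
noncomputable def Xm (n : ℕ) : Matrix (Fin n → Bool) (Fin n → Bool) ℝ :=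
  Matrix.diagonal fun x => (wt x : ℝ)

/-- The matrix `B_q` built from `q : {0,1}^n → ℝ`: entry `(x,y)` equals `(q(x)-q(y))/2`
when `x` and `y` differ in exactly one coordinate, and `0` otherwise. -/
noncomputable def Bq {n : ℕ} (q : (Fin n → Bool) → ℝ) :
    Matrix (Fin n → Bool) (Fin n → Bool) ℝ :=
  Matrix.of fun x y => if hammingDist x y = 1 then (q x - q y) / 2 else 0

/-- Maximum ℓ2 norm of a column of `X`. -/
noncomputable def colNorm {k m : Type*} [Fintype k] [Fintype m] (X : Matrix k m ℝ) : ℝ :=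
  ⨆ j : m, Real.sqrt (∑ i, X i j ^ 2)

/-- The `γ₂` (factorization) norm of a real matrix `A`:
`γ₂(A) = min { c(X)·c(Y) : XᵀY = A }` where `c(·)` is the maximum column ℓ2 norm. -/
noncomputable def gamma2 {m l : Type*} [Fintype m] [Fintype l] (A : Matrix m l ℝ) : ℝ :=
  sInf {c : ℝ | ∃ (k : ℕ) (X : Matrix (Fin k) m ℝ) (Y : Matrix (Fin k) l ℝ),
    X.transpose * Y = A ∧ c = colNorm X * colNorm Y}

open scoped Matrix.Norms.L2Operator in
theorem specNorm_mul_le {I : Type*} [Fintype I] [DecidableEq I] (A B : Matrix I I ℝ) :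
    specNorm (A * B) ≤ specNorm A * specNorm B :=
  Matrix.l2_opNorm_mul A B

theorem specNorm_nonneg {I : Type*} [Fintype I] [DecidableEq I] (A : Matrix I I ℝ) :
    0 ≤ specNorm A :=
  norm_nonneg _

open scoped Matrix.Norms.L2Operator in
theorem specNorm_diagonal_le {I : Type*} [Fintype I] [DecidableEq I] {f : I → ℝ} {c : ℝ}
    (hc : 0 ≤ c) (hf : ∀ i, |f i| ≤ c) : specNorm (Matrix.diagonal f) ≤ c := by
  have h : specNorm (Matrix.diagonal f) = ‖f‖ := Matrix.l2_opNorm_diagonal f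
  rw [h]
  exact (pi_norm_le_iff_of_nonneg hc).2 hf

open scoped Matrix.Norms.L2Operator in
/-- A symmetric involution has spectral norm at most one. -/
theorem specNorm_le_one_of_mul_self {I : Type*} [Fintype I] [DecidableEq I] {A : Matrix I I ℝ}
    (hA : A.transpose = A) (hAA : A * A = 1) : specNorm A ≤ 1 := by
  have h : ‖A.conjTranspose * A‖ = specNorm A * specNorm A :=
    Matrix.l2_opNorm_conjTranspose_mul_self A
  have h1 : specNorm (1 : Matrix I I ℝ) ≤ 1 := by
    rw [← Matrix.diagonal_one]
    exact specNorm_diagonal_le zero_le_one (by simp)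
  rw [Matrix.conjTranspose_eq_transpose_of_trivial, hA, hAA] at h
  have h2 : specNorm A * specNorm A ≤ 1 := h ▸ h1
  nlinarith [specNorm_nonneg A]

theorem abs_dotProduct_mulVec_le {I : Type*} [Fintype I] [DecidableEq I] (A : Matrix I I ℝ)
    (u v : I → ℝ) :
    |u ⬝ᵥ A.mulVec v| ≤ specNorm A * (√(∑ i, u i ^ 2) * √(∑ i, v i ^ 2)) := by
  have h := abs_real_inner_le_norm (WithLp.toLp 2 u)
    (Matrix.toEuclideanCLM (𝕜 := ℝ) A (WithLp.toLp 2 v))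
  have h' := (Matrix.toEuclideanCLM (𝕜 := ℝ) A).le_opNorm (WithLp.toLp 2 v)
  rw [Matrix.inner_toEuclideanCLM] at h
  have hu : ‖WithLp.toLp 2 u‖ = √(∑ i, u i ^ 2) := by simp [EuclideanSpace.norm_eq]
  have hv : ‖WithLp.toLp 2 v‖ = √(∑ i, v i ^ 2) := by simp [EuclideanSpace.norm_eq]
  rw [hu] at h
  rw [hv] at h'
  refine h.trans ((mul_le_mul_of_nonneg_left h' (Real.sqrt_nonneg _)).trans_eq ?_)
  simp only [specNorm]
  ring

theorem specNorm_le_of_abs_dotProduct_le {I : Type*} [Fintype I] [DecidableEq I]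
    {A : Matrix I I ℝ} {c : ℝ} (hc : 0 ≤ c)
    (h : ∀ u v : I → ℝ, |u ⬝ᵥ A.mulVec v| ≤ c * (√(∑ i, u i ^ 2) * √(∑ i, v i ^ 2))) :
    specNorm A ≤ c := by
  refine ContinuousLinearMap.opNorm_le_of_re_inner_le hc fun x y => ?_
  have := (le_abs_self _).trans (h y.ofLp x.ofLp)
  rw [← Matrix.inner_toEuclideanCLM] at this
  rw [EuclideanSpace.norm_eq, EuclideanSpace.norm_eq, RCLike.re_to_real, real_inner_comm]
  simp only [Real.norm_eq_abs, sq_abs]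
  intro hx hy
  rwa [hx, hy, mul_one, mul_one] at this

theorem colNorm_nonneg {k m : Type*} [Fintype k] [Fintype m] (X : Matrix k m ℝ) :
    0 ≤ colNorm X :=
  Real.iSup_nonneg fun _ => Real.sqrt_nonneg _

theorem sum_sq_le_colNorm_sq {k m : Type*} [Fintype k] [Fintype m] (X : Matrix k m ℝ) (j : m) :
    ∑ i, X i j ^ 2 ≤ colNorm X ^ 2 := by
  have h : √(∑ i, X i j ^ 2) ≤ colNorm X :=
    le_ciSup (f := fun j => √(∑ i, X i j ^ 2)) (Set.finite_range _).bddAbove j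
  exact (Real.sqrt_le_left (colNorm_nonneg X)).1 h

theorem sqrt_sum_sum_mul_sq_le {k m : Type*} [Fintype k] [Fintype m] (X : Matrix k m ℝ)
    (u : m → ℝ) : √(∑ i, ∑ j, (X i j * u j) ^ 2) ≤ colNorm X * √(∑ j, u j ^ 2) := by
  rw [← Real.sqrt_sq (colNorm_nonneg X), ← Real.sqrt_mul (sq_nonneg _)]
  refine Real.sqrt_le_sqrt ?_
  rw [Finset.sum_comm, Finset.mul_sum]
  refine Finset.sum_le_sum fun j _ => ?_
  simp only [mul_pow, ← Finset.sum_mul]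
  exact mul_le_mul_of_nonneg_right (sum_sq_le_colNorm_sq X j) (sq_nonneg _)

/-- The Schur multiplier norm of `Xᵀ * Y` is at most `colNorm X * colNorm Y`. -/
theorem specNorm_hadamard_le {I k : Type*} [Fintype I] [DecidableEq I] [Fintype k]
    (A : Matrix I I ℝ) (X Y : Matrix k I ℝ) :
    specNorm (Matrix.of fun x y => A x y * (X.transpose * Y) x y) ≤
      specNorm A * (colNorm X * colNorm Y) := by
  refine specNorm_le_of_abs_dotProduct_le (mul_nonneg (specNorm_nonneg A)
    (mul_nonneg (colNorm_nonneg X) (colNorm_nonneg Y))) fun u v => ?_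
  have key : u ⬝ᵥ (Matrix.of fun x y => A x y * (X.transpose * Y) x y).mulVec v =
      ∑ i, (fun x => X i x * u x) ⬝ᵥ A.mulVec (fun y => Y i y * v y) := by
    simp only [dotProduct, Matrix.mulVec, Matrix.of_apply, Matrix.mul_apply,
      Matrix.transpose_apply, Finset.mul_sum, Finset.sum_mul]
    conv_rhs => rw [Finset.sum_comm]
    refine Finset.sum_congr rfl fun x _ => ?_
    conv_rhs => rw [Finset.sum_comm]
    refine Finset.sum_congr rfl fun y _ => Finset.sum_congr rfl fun i _ => ?_
    ring
  rw [key]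
  calc |∑ i, (fun x => X i x * u x) ⬝ᵥ A.mulVec (fun y => Y i y * v y)|
      ≤ ∑ i, specNorm A * (√(∑ x, (X i x * u x) ^ 2) * √(∑ y, (Y i y * v y) ^ 2)) :=
        (Finset.abs_sum_le_sum_abs _ _).trans
          (Finset.sum_le_sum fun i _ => abs_dotProduct_mulVec_le A _ _)
    _ ≤ specNorm A * (√(∑ i, ∑ x, (X i x * u x) ^ 2) * √(∑ i, ∑ y, (Y i y * v y) ^ 2)) := by
        rw [← Finset.mul_sum]
        exact mul_le_mul_of_nonneg_left (Real.sum_sqrt_mul_sqrt_le _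
          (fun _ => Finset.sum_nonneg fun _ _ => sq_nonneg _)
          (fun _ => Finset.sum_nonneg fun _ _ => sq_nonneg _)) (specNorm_nonneg A)
    _ ≤ specNorm A * ((colNorm X * √(∑ x, u x ^ 2)) * (colNorm Y * √(∑ y, v y ^ 2))) :=
        mul_le_mul_of_nonneg_left (mul_le_mul (sqrt_sum_sum_mul_sq_le X u)
          (sqrt_sum_sum_mul_sq_le Y v) (Real.sqrt_nonneg _)
          (mul_nonneg (colNorm_nonneg X) (Real.sqrt_nonneg _))) (specNorm_nonneg A)
    _ = _ := by ring

theorem Hmat_apply {n : ℕ} (x y : Fin n → Bool) :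
    Hmat n x y = (∏ i, if x i ∧ y i then (-1 : ℝ) else 1) / √(2 ^ n) := by
  simp [Hmat, Finset.prod_ite]

theorem Hmat_transpose (n : ℕ) : (Hmat n).transpose = Hmat n := by
  ext x y
  simp only [Matrix.transpose_apply, Hmat_apply, and_comm]

theorem Hmat_conj_apply {n : ℕ} (f : (Fin n → Bool) → ℝ) (x y : Fin n → Bool) :
    (Hmat n * Matrix.diagonal f * Hmat n) x y = ∑ z, f z * (Hmat n x z * Hmat n z y) := by
  rw [Matrix.mul_apply]
  refine Finset.sum_congr rfl fun z _ => ?_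
  rw [Matrix.mul_diagonal]
  ring

/-- Conjugating a diagonal matrix whose entries factor over coordinates. -/
theorem Hmat_conj_prod_apply {n : ℕ} (f : Fin n → Bool → ℝ) (x y : Fin n → Bool) :
    (Hmat n * Matrix.diagonal (fun z : Fin n → Bool => ∏ i, f i (z i)) * Hmat n) x y =
      (∏ i, (f i true * (if x i = y i then 1 else -1) + f i false)) / 2 ^ n := by
  have h : ∀ z, (∏ i, f i (z i)) * (Hmat n x z * Hmat n z y) =
      (∏ i, f i (z i) * ((if x i ∧ z i then (-1 : ℝ) else 1) *
        (if z i ∧ y i then (-1 : ℝ) else 1))) / 2 ^ n := by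
    intro z
    rw [Hmat_apply, Hmat_apply, div_mul_div_comm, Real.mul_self_sqrt (by positivity),
      Finset.prod_mul_distrib, Finset.prod_mul_distrib, mul_div_assoc']
  rw [Hmat_conj_apply, Finset.sum_congr rfl fun z _ => h z, ← Finset.sum_div,
    ← Fintype.piFinset_univ, ← Finset.prod_univ_sum (fun _ => Finset.univ)
      (fun i b => f i b * ((if x i ∧ b then (-1 : ℝ) else 1) * (if b ∧ y i then (-1 : ℝ) else 1)))]
  congr 1
  refine Finset.prod_congr rfl fun i _ => ?_
  rw [Fintype.sum_bool]
  cases x i <;> cases y i <;> simp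

theorem Hmat_mul_self (n : ℕ) : Hmat n * Hmat n = 1 := by
  ext x y
  have h := Hmat_conj_prod_apply (fun _ _ => 1) x y
  simp only [Finset.prod_const_one, Matrix.diagonal_one, mul_one, one_mul] at h
  rw [h]
  by_cases hxy : x = y
  · subst hxy
    norm_num
  · obtain ⟨i, hi⟩ := Function.ne_iff.1 hxy
    rw [Matrix.one_apply_ne hxy, Finset.prod_eq_zero (Finset.mem_univ i) (by simp [hi]), zero_div]

/-- The Fourier coefficients of a polynomial of degree `d` vanish above level `d`. -/
theorem Hmat_conj_apply_eq_zero {n d : ℕ} {p : MvPolynomial (Fin n) ℝ} (hp : p.totalDegree ≤ d)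
    {x y : Fin n → Bool} (hxy : d < hammingDist x y) :
    (Hmat n * Matrix.diagonal
      (fun z : Fin n → Bool => MvPolynomial.eval (fun i => if z i then (1 : ℝ) else 0) p) * Hmat n) x y = 0 := by
  rw [Hmat_conj_apply]
  simp only [MvPolynomial.eval_eq', Finset.sum_mul]
  rw [Finset.sum_comm]
  refine Finset.sum_eq_zero fun m hm => ?_
  have h := Hmat_conj_prod_apply (fun i b => (if b then (1 : ℝ) else 0) ^ m i) x y
  rw [Hmat_conj_apply] at h
  simp only [mul_assoc, ← Finset.mul_sum]
  rw [h]
  obtain ⟨i, hi, hmi⟩ : ∃ i, x i ≠ y i ∧ m i = 0 := by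
    by_contra! hcon
    have h1 : hammingDist x y ≤ m.support.card :=
      Finset.card_le_card fun i hi => Finsupp.mem_support_iff.2
        (hcon i (Finset.mem_filter.1 hi).2)
    have h2 : m.support.card ≤ m.sum fun _ e => e := by
      rw [Finset.card_eq_sum_ones]
      exact Finset.sum_le_sum fun i hi =>
        Nat.one_le_iff_ne_zero.2 (Finsupp.mem_support_iff.1 hi)
    have h3 := MvPolynomial.le_totalDegree hm
    omega
  rw [Finset.prod_eq_zero (Finset.mem_univ i) (by simp [hi, hmi]), zero_div, mul_zero]

theorem wt_eq_sum_prod {n : ℕ} (z : Fin n → Bool) :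
    (wt z : ℝ) = ∑ j, ∏ i, if i = j then (if z i then (1 : ℝ) else 0) else 1 := by
  simp [wt]

/-- Off the diagonal, conjugating `Xm` gives `-1/2` times the hypercube adjacency matrix. -/
theorem Hmat_conj_Xm_apply {n : ℕ} {x y : Fin n → Bool} (hxy : x ≠ y) :
    (Hmat n * Xm n * Hmat n) x y = if hammingDist x y = 1 then -(1 / 2) else 0 := by
  have h : (Hmat n * Xm n * Hmat n) x y = ∑ j, (∏ i, ((if i = j then (1 : ℝ) else 1) *
      (if x i = y i then 1 else -1) + (if i = j then 0 else 1))) / 2 ^ n := by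
    rw [Xm, Hmat_conj_apply]
    simp only [wt_eq_sum_prod, Finset.sum_mul]
    rw [Finset.sum_comm]
    refine Finset.sum_congr rfl fun j _ => ?_
    rw [← Hmat_conj_apply, Hmat_conj_prod_apply
      (fun i b => if i = j then (if b then (1 : ℝ) else 0) else 1)]
    simp
  rw [h]
  split_ifs with hd
  · obtain ⟨k, hk⟩ := Finset.card_eq_one.1 hd
    have hk' : ∀ i, x i ≠ y i ↔ i = k := fun i => by
      simpa using Finset.ext_iff.1 hk i
    rw [Finset.sum_eq_single k]
    · have hn : 0 < n := k.pos
      rw [← Finset.mul_prod_erase _ _ (Finset.mem_univ k), if_neg ((hk' k).2 rfl),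
        Finset.prod_congr rfl (g := fun _ => (2 : ℝ))]
      · obtain ⟨m, rfl⟩ : ∃ m, n = m + 1 := ⟨n - 1, by omega⟩
        simp [pow_succ]
        field_simp
      · intro i hi
        have hik := (Finset.mem_erase.1 hi).1
        have : x i = y i := by
          by_contra hne
          exact hik ((hk' i).1 hne)
        simp [hik, this]
        norm_num
    · intro j _ hj
      rw [Finset.prod_eq_zero (Finset.mem_univ k), zero_div]
      simp [(hk' k).2 rfl, Ne.symm hj]
    · simp
  · refine Finset.sum_eq_zero fun j _ => ?_
    obtain ⟨i, hi, hij⟩ : ∃ i, x i ≠ y i ∧ i ≠ j := by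
      by_contra! hcon
      have h1 : hammingDist x y ≤ ({j} : Finset (Fin n)).card :=
        Finset.card_le_card fun i hi =>
          Finset.mem_singleton.2 (hcon i (Finset.mem_filter.1 hi).2)
      have h2 := hammingDist_pos.2 hxy
      rw [Finset.card_singleton] at h1
      omega
    rw [Finset.prod_eq_zero (Finset.mem_univ i) (by simp [hi, hij]), zero_div]

theorem abs_wt_sub_wt_le {n : ℕ} (x y : Fin n → Bool) :
    |(wt x : ℝ) - wt y| ≤ hammingDist x y := by
  have hx : ∀ z : Fin n → Bool, (wt z : ℝ) = ∑ i, if z i then (1 : ℝ) else 0 := by simp [wt]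
  have hd : (hammingDist x y : ℝ) = ∑ i, if x i ≠ y i then (1 : ℝ) else 0 := by
    simp only [hammingDist, Finset.card_filter]
    push_cast
    rfl
  rw [hx, hx, hd, ← Finset.sum_sub_distrib]
  refine (Finset.abs_sum_le_sum_abs _ _).trans (Finset.sum_le_sum fun i _ => ?_)
  cases x i <;> cases y i <;> simp

theorem Bq_eq_commutator {n : ℕ} (q : (Fin n → Bool) → ℝ) :
    Bq q = (Hmat n * Xm n * Hmat n) * Matrix.diagonal q -
      Matrix.diagonal q * (Hmat n * Xm n * Hmat n) := by
  ext x y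
  rw [Matrix.sub_apply, Matrix.mul_diagonal, Matrix.diagonal_mul]
  by_cases hxy : x = y
  · subst hxy
    simp [Bq, mul_comm]
  · rw [Hmat_conj_Xm_apply hxy, Bq, Matrix.of_apply]
    split_ifs <;> ring

theorem gamma2_set_nonempty {m l : Type*} [Fintype m] [Fintype l] (A : Matrix m l ℝ) :
    {c : ℝ | ∃ (k : ℕ) (X : Matrix (Fin k) m ℝ) (Y : Matrix (Fin k) l ℝ),
      X.transpose * Y = A ∧ c = colNorm X * colNorm Y}.Nonempty := by
  classical
  let e := (Fintype.equivFin m).symm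
  refine ⟨_, Fintype.card m, (1 : Matrix m m ℝ).submatrix e id, A.submatrix e id, ?_, rfl⟩
  rw [Matrix.transpose_submatrix, Matrix.submatrix_mul_equiv, Matrix.transpose_one, Matrix.one_mul,
    Matrix.submatrix_id_id]

/-- If `q` agrees on the cube with a polynomial of degree at most `d`,
`|q(x)| ≤ 1` everywhere, and `V` is any matrix with `V x y = |x| - |y|` whenever
`||x| - |y|| ≤ d`, then `‖B_q‖ ≤ γ₂(V)`. -/
theorem Bq_le_gamma2 (n d : ℕ) (q : (Fin n → Bool) → ℝ)
    (hdeg : ∃ p : MvPolynomial (Fin n) ℝ, p.totalDegree ≤ d ∧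
      ∀ x : Fin n → Bool, MvPolynomial.eval (fun i => if x i then (1 : ℝ) else 0) p = q x)
    (hq : ∀ x, |q x| ≤ 1)
    (V : Matrix (Fin n → Bool) (Fin n → Bool) ℝ)
    (hV : ∀ x y : Fin n → Bool, |(wt x : ℝ) - (wt y : ℝ)| ≤ (d : ℝ) →
      V x y = (wt x : ℝ) - (wt y : ℝ)) :
    specNorm (Bq q) ≤ gamma2 V := by
  obtain ⟨p, hp, hpq⟩ := hdeg
  refine le_csInf (gamma2_set_nonempty V) ?_
  rintro _ ⟨k, X, Y, hXY, rfl⟩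
  set Q := Hmat n * Matrix.diagonal q * Hmat n with hQ
  have hH : specNorm (Hmat n) ≤ 1 :=
    specNorm_le_one_of_mul_self (Hmat_transpose n) (Hmat_mul_self n)
  have conj_le : ∀ A, specNorm (Hmat n * A * Hmat n) ≤ specNorm A := fun A =>
    calc specNorm (Hmat n * A * Hmat n)
        ≤ specNorm (Hmat n * A) * specNorm (Hmat n) := specNorm_mul_le _ _
      _ ≤ specNorm (Hmat n * A) := mul_le_of_le_one_right (specNorm_nonneg _) hH
      _ ≤ specNorm (Hmat n) * specNorm A := specNorm_mul_le _ _
      _ ≤ specNorm A := mul_le_of_le_one_left (specNorm_nonneg _) hH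
  have hQ1 : specNorm Q ≤ 1 := (conj_le _).trans (specNorm_diagonal_le zero_le_one hq)
  have hQV : Xm n * Q - Q * Xm n = Matrix.of fun x y => Q x y * (X.transpose * Y) x y := by
    ext x y
    rw [Matrix.of_apply, Matrix.sub_apply, Xm, Matrix.diagonal_mul, Matrix.mul_diagonal, hXY]
    rcases le_or_gt (hammingDist x y) d with hd | hd
    · rw [hV x y ((abs_wt_sub_wt_le x y).trans (by exact_mod_cast hd))]
      ring
    · have hz : Q x y = 0 := by
        rw [hQ, ← funext hpq]
        exact Hmat_conj_apply_eq_zero hp hd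
      simp [hz]
  have hB : Bq q = Hmat n * (Xm n * Q - Q * Xm n) * Hmat n := by
    have hHH : ∀ A, Hmat n * (Hmat n * A) = A := fun A => by
      rw [← Matrix.mul_assoc, Hmat_mul_self, Matrix.one_mul]
    rw [Bq_eq_commutator, hQ]
    simp only [Matrix.mul_sub, Matrix.sub_mul, Matrix.mul_assoc, hHH, Hmat_mul_self,
      Matrix.mul_one]
  rw [hB, hQV]
  exact (conj_le _).trans ((specNorm_hadamard_le Q X Y).trans
    (mul_le_of_le_one_left (mul_nonneg (colNorm_nonneg X) (colNorm_nonneg Y)) hQ1))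
end

section
/- Let M be any (n+1) × (n+1) real matrix with rows and columns indexed by {0,1,...,n}, and define the 2^n × 2^n matrix V by V_{xy} = M_{|x|,|y|} for x, y ∈ {0,1}^n. Then γ₂(V) ≤ γ₂(M). In particular, if M satisfies M_{st} = s − t for all s, t with |s − t| ≤ d, then V satisfies V_{xy} = |x| − |y| whenever ||x| − |y|| ≤ d and γ₂(V) ≤ γ₂(M). -/
/-- Hamming weight of `x ∈ {0,1}^n`, as an element of `Fin (n+1)`. -/
def wtFin {n : ℕ} (x : Fin n → Bool) : Fin (n + 1) :=
  ⟨wt x, Nat.lt_succ_of_le ((Finset.card_filter_le _ _).trans (by simp))⟩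

theorem colNorm_submatrix_le {k m m' : Type*} [Fintype k] [Fintype m] [Fintype m']
    (X : Matrix k m ℝ) (f : m' → m) : colNorm (X.submatrix id f) ≤ colNorm X :=
  Real.iSup_le
    (fun j => le_ciSup (f := fun j => Real.sqrt (∑ i, X i j ^ 2)) (Set.finite_range _).bddAbove
      (f j))
    (colNorm_nonneg X)

/-- Every real matrix has a factorization `A = Xᵀ * Y` with finite inner dimension. -/
theorem exists_transpose_mul_eq {m l : Type*} [Fintype m] (A : Matrix m l ℝ) :
    ∃ (k : ℕ) (X : Matrix (Fin k) m ℝ) (Y : Matrix (Fin k) l ℝ), X.transpose * Y = A := by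
  classical
  let e := (Fintype.equivFin m).symm
  refine ⟨Fintype.card m, (1 : Matrix m m ℝ).submatrix e id, A.submatrix e id, ?_⟩
  rw [Matrix.transpose_submatrix, Matrix.submatrix_mul_equiv]
  simp

/-- Duplicating, permuting or deleting rows and columns does not increase `γ₂`. -/
theorem gamma2_submatrix_le {m l m' l' : Type*} [Fintype m] [Fintype l] [Fintype m'] [Fintype l']
    (A : Matrix m l ℝ) (f : m' → m) (g : l' → l) : gamma2 (A.submatrix f g) ≤ gamma2 A := by
  obtain ⟨k, X, Y, h⟩ := exists_transpose_mul_eq A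
  refine le_csInf ⟨_, k, X, Y, h, rfl⟩ ?_
  rintro c ⟨k, X, Y, rfl, rfl⟩
  refine csInf_le_of_le ⟨0, ?_⟩
    ⟨k, X.submatrix id f, Y.submatrix id g, ?_, rfl⟩
    (mul_le_mul (colNorm_submatrix_le X f) (colNorm_submatrix_le Y g) (colNorm_nonneg _)
      (colNorm_nonneg _))
  · rintro c ⟨k, X, Y, -, rfl⟩
    exact mul_nonneg (colNorm_nonneg X) (colNorm_nonneg Y)
  · ext i j
    simp [Matrix.mul_apply]

/-- If `V` is obtained from the `(n+1) × (n+1)` matrix `M` by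
`V x y = M |x| |y|`, then `γ₂(V) ≤ γ₂(M)`; in particular, if `M s t = s - t` whenever
`|s - t| ≤ d`, then `V x y = |x| - |y|` whenever `||x| - |y|| ≤ d`, and `γ₂(V) ≤ γ₂(M)`. -/
theorem gamma2_pullback (n d : ℕ) (M : Matrix (Fin (n + 1)) (Fin (n + 1)) ℝ) :
    gamma2 (Matrix.of fun x y : Fin n → Bool => M (wtFin x) (wtFin y)) ≤ gamma2 M ∧
    ((∀ s t : Fin (n + 1), |(s : ℝ) - (t : ℝ)| ≤ (d : ℝ) → M s t = (s : ℝ) - (t : ℝ)) →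
      (∀ x y : Fin n → Bool, |(wt x : ℝ) - (wt y : ℝ)| ≤ (d : ℝ) →
        (Matrix.of fun x y : Fin n → Bool => M (wtFin x) (wtFin y)) x y
          = (wt x : ℝ) - (wt y : ℝ)) ∧
      gamma2 (Matrix.of fun x y : Fin n → Bool => M (wtFin x) (wtFin y)) ≤ gamma2 M) := by
  have h := gamma2_submatrix_le M (wtFin (n := n)) wtFin
  exact ⟨h, fun hM => ⟨fun x y hxy => hM (wtFin x) (wtFin y) hxy, h⟩⟩
end

section
/- For all total Boolean functions f : {0,1}^n → {0,1} and g : {0,1}^m → {0,1}, the composed function f ∘ g : {0,1}^{nm} → {0,1}, defined by (f ∘ g)(x^{(1)}, ..., x^{(n)}) = f(g(x^{(1)}), ..., g(x^{(n)})) where each x^{(i)} ∈ {0,1}^m, satisfies λ(f ∘ g) = λ(f) · λ(g). -/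
open Finset Function

section SpecNorm

variable {I : Type*} [Fintype I] [DecidableEq I] (A : Matrix I I ℝ)

theorem specNorm_nonneg_s16 : 0 ≤ specNorm A := norm_nonneg _

theorem sqrt_sum_sq_mulVec_le (v : I → ℝ) :
    √(∑ x, (A.mulVec v x) ^ 2) ≤ specNorm A * √(∑ x, v x ^ 2) := by
  have h := (Matrix.toEuclideanCLM (𝕜 := ℝ) A).le_opNorm (WithLp.toLp 2 v)
  rw [Matrix.toEuclideanCLM_toLp] at h
  simpa [EuclideanSpace.norm_eq, specNorm] using h

theorem specNorm_le_of_forall_sqrt {C : ℝ} (hC : 0 ≤ C)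
    (h : ∀ v : I → ℝ, √(∑ x, (A.mulVec v x) ^ 2) ≤ C * √(∑ x, v x ^ 2)) :
    specNorm A ≤ C := by
  refine ContinuousLinearMap.opNorm_le_bound _ hC fun v => ?_
  have := h v.ofLp
  obtain ⟨v⟩ := v
  rw [Matrix.toEuclideanCLM_toLp]
  simpa [EuclideanSpace.norm_eq] using this

theorem sum_mul_mulVec_le (a b : I → ℝ) :
    ∑ x, a x * A.mulVec b x ≤ specNorm A * (√(∑ x, a x ^ 2) * √(∑ x, b x ^ 2)) := by
  calc _ ≤ √(∑ x, a x ^ 2) * √(∑ x, (A.mulVec b x) ^ 2) := Real.sum_mul_le_sqrt_mul_sqrt _ _ _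
    _ ≤ √(∑ x, a x ^ 2) * (specNorm A * √(∑ x, b x ^ 2)) := by
      gcongr
      exact sqrt_sum_sq_mulVec_le A b
    _ = _ := by ring

theorem specNorm_le_of_forall_bilin {C : ℝ} (hC : 0 ≤ C)
    (h : ∀ a b : I → ℝ,
      ∑ x, a x * A.mulVec b x ≤ C * (√(∑ x, a x ^ 2) * √(∑ x, b x ^ 2))) :
    specNorm A ≤ C := by
  refine specNorm_le_of_forall_sqrt A hC fun v => ?_
  have h1 := h (A.mulVec v) v
  have h2 : ∑ x, A.mulVec v x * A.mulVec v x = √(∑ x, (A.mulVec v x) ^ 2) ^ 2 := by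
    rw [Real.sq_sqrt (by positivity)]
    simp [sq]
  rw [h2] at h1
  rcases (Real.sqrt_nonneg (∑ x, (A.mulVec v x) ^ 2)).eq_or_lt with h0 | h0
  · rw [← h0]; positivity
  · nlinarith

/-- A real symmetric matrix has an eigenvalue whose modulus is its spectral norm. -/
theorem exists_eigenvector_abs_eq_specNorm [Nonempty I] (hA : A.IsSymm) :
    ∃ (μ : ℝ) (v : I → ℝ), |μ| = specNorm A ∧ v ≠ 0 ∧ A.mulVec v = μ • v := by
  set T := Matrix.toEuclideanCLM (𝕜 := ℝ) A with hT
  have hsymm : ∀ x y, inner ℝ (T x) y = inner ℝ x (T y) := by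
    have : IsSelfAdjoint T := by
      have hA' : IsSelfAdjoint A := by
        rw [IsSelfAdjoint, Matrix.star_eq_conjTranspose, Matrix.conjTranspose_eq_transpose_of_trivial]
        exact hA
      exact hA'.map _
    exact this.isSymmetric
  obtain ⟨v, hv, hmax⟩ := (isCompact_sphere (0 : EuclideanSpace ℝ I) 1).exists_isMaxOn
    (NormedSpace.sphere_nonempty.2 zero_le_one) (f := fun v => ‖T v‖) (by fun_prop)
  have hv1 : ‖v‖ = 1 := by simpa using hv
  have hle : ‖T‖ ≤ ‖T v‖ := by
    refine ContinuousLinearMap.opNorm_le_of_unit_norm (norm_nonneg _) fun x hx => ?_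
    exact hmax (by simpa using hx)
  have hnorm : ‖T v‖ = ‖T‖ := le_antisymm (by simpa [hv1] using T.le_opNorm v) hle
  have hsq : T (T v) = (‖T‖ ^ 2) • v := by
    rw [← sub_eq_zero, ← norm_eq_zero, ← sq_eq_zero_iff]
    refine le_antisymm ?_ (sq_nonneg _)
    rw [norm_sub_sq_real, inner_smul_right, hsymm, real_inner_self_eq_norm_sq, hnorm, norm_smul,
      hv1]
    have h1 : ‖T (T v)‖ ≤ ‖T‖ * ‖T‖ := hnorm ▸ T.le_opNorm (T v)
    have h2 : ‖T (T v)‖ ^ 2 ≤ (‖T‖ * ‖T‖) ^ 2 := by gcongr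
    simp only [norm_pow, norm_norm]
    nlinarith
  have hconv : ∀ (μ : ℝ) (w : EuclideanSpace ℝ I), T w = μ • w → A.mulVec w.ofLp = μ • w.ofLp := by
    rintro μ ⟨w⟩ h
    rw [hT, Matrix.toEuclideanCLM_toLp] at h
    exact congrArg WithLp.ofLp h
  by_cases h0 : T v + ‖T‖ • v = 0
  · refine ⟨-‖T‖, v.ofLp, by rw [abs_neg, abs_norm]; rfl, ?_, hconv _ _ ?_⟩
    · intro h
      have : v = 0 := by ext i; exact congrFun h i
      simp [this] at hv1
    · rw [neg_smul]; exact eq_neg_of_add_eq_zero_left h0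
  · refine ⟨‖T‖, (T v + ‖T‖ • v).ofLp, by rw [abs_norm]; rfl, ?_, hconv _ _ ?_⟩
    · intro h
      exact h0 (by ext i; exact congrFun h i)
    · rw [map_add, hsq, map_smul, smul_add, smul_smul, sq, add_comm]

end SpecNorm

section Sensitivity

variable {I : Type*} [Fintype I] [DecidableEq I]

theorem hammingDist_update_not (x : I → Bool) (i : I) :
    hammingDist x (update x i (!x i)) = 1 := by
  rw [hammingDist, card_eq_one]
  refine ⟨i, ?_⟩
  ext j
  by_cases h : j = i
  · subst h; simp
  · simp [h]

theorem exists_eq_update_not_of_hammingDist_eq_one {x y : I → Bool} (h : hammingDist x y = 1) :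
    ∃ i, update x i (!x i) = y := by
  rw [hammingDist, card_eq_one] at h
  obtain ⟨i, hi⟩ := h
  refine ⟨i, funext fun j => ?_⟩
  have hj := Finset.ext_iff.1 hi j
  by_cases h : j = i
  · subst h
    simp only [mem_filter, mem_univ, true_and, mem_singleton, iff_true] at hj
    simpa [Bool.eq_not, eq_comm] using hj
  · simpa [h] using hj

theorem sensAdj_mulVec (f : (I → Bool) → Bool) (v : (I → Bool) → ℝ) (x : I → Bool) :
    (sensAdj f).mulVec v x
      = ∑ i, if f x ≠ f (update x i (!x i)) then v (update x i (!x i)) else 0 := by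
  symm
  refine sum_of_injOn (fun i => update x i (!x i)) ?_ (by simp) ?_ ?_
  · intro i _ j _ hij
    by_contra hne
    have := congrFun hij i
    simp [hne] at this
  · intro y _ hy
    have : hammingDist x y ≠ 1 := fun h => by
      obtain ⟨i, hi⟩ := exists_eq_update_not_of_hammingDist_eq_one h
      exact hy ⟨i, by simp, hi⟩
    simp [sensAdj, this]
  · intro i _
    simp [sensAdj, hammingDist_update_not]

theorem sensAdj_isSymm (f : (I → Bool) → Bool) : (sensAdj f).IsSymm := by
  ext x y
  simp [sensAdj, hammingDist_comm, eq_comm]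

theorem sensAdj_eq_zero_of_eq {f : (I → Bool) → Bool} {x y : I → Bool} (h : f x = f y) :
    sensAdj f x y = 0 := by
  simp [sensAdj, h]

end Sensitivity

section Composition

theorem comp_update_apply {ι α β : Type*} [DecidableEq ι] (g : α → β) (x : ι → α) (i : ι) (u : α) :
    (fun k => g (update x i u k)) = update (fun k => g (x k)) i (g u) := by
  ext k
  by_cases h : k = i
  · subst h; simp
  · simp [h]

theorem sensAdj_mul_apply_comp_update {ι κ : Type*} [DecidableEq ι] [Fintype κ]
    [DecidableEq κ] (g : (κ → Bool) → Bool) (h : (ι → Bool) → ℝ)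
    (x : ι → κ → Bool) (i : ι) (u : κ → Bool) :
    sensAdj g (x i) u * h (fun k => g (update x i u k))
      = sensAdj g (x i) u * h (update (fun k => g (x k)) i (!g (x i))) := by
  by_cases hu : g (x i) = g u
  · simp [sensAdj_eq_zero_of_eq hu]
  · have h' : g u = !g (x i) := by
      rw [Bool.eq_not]; exact fun h'' => hu h''.symm
    rw [comp_update_apply, h']

variable {ι κ : Type*} [Fintype ι] [DecidableEq ι] [Fintype κ] [DecidableEq κ]

theorem sensAdj_comp_mulVec (f : (ι → Bool) → Bool) (g : (κ → Bool) → Bool)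
    (v : (ι → κ → Bool) → ℝ) (x : ι × κ → Bool) :
    (sensAdj fun x : ι × κ → Bool => f fun i => g fun j => x (i, j)).mulVec (fun y => v (curry y)) x
      = ∑ i, if f (fun k => g (curry x k)) ≠
            f (update (fun k => g (curry x k)) i (!g (curry x i))) then
          (sensAdj g).mulVec (fun u => v (update (curry x) i u)) (curry x i) else 0 := by
  rw [sensAdj_mulVec, Fintype.sum_prod_type]
  refine sum_congr rfl fun i _ => ?_
  have hcurry : ∀ j, curry (update x (i, j) (!x (i, j)))
      = update (curry x) i (update (curry x i) j (!curry x i j)) := fun j => by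
    ext k l
    by_cases hk : k = i
    · subst hk
      by_cases hl : l = j
      · subst hl; simp [curry]
      · simp [curry, hl]
    · simp [curry, hk]
  have hcomp : ∀ j, (fun k => g fun l => update x (i, j) (!x (i, j)) (k, l))
      = update (fun k => g (curry x k)) i (g (update (curry x i) j (!curry x i j))) := fun j => by
    rw [← comp_update_apply, ← hcurry]
    rfl
  have hG : (fun k => g fun l => x (k, l)) = fun k => g (curry x k) := rfl
  simp only [sensAdj_mulVec, hcomp, hcurry, hG]
  have hdist : ∀ (p : Prop) [Decidable p] (F : κ → ℝ),
      (if p then ∑ j, F j else 0) = ∑ j, if p then F j else 0 := fun p _ F => by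
    by_cases h : p <;> simp [h]
  rw [hdist]
  refine sum_congr rfl fun j _ => ?_
  generalize update (curry x i) j (!curry x i j) = u
  by_cases h : g (curry x i) = g u
  · rw [← h, update_eq_self (f := fun k => g (curry x k))]
    simp
  · have h' : g u = !g (curry x i) := by
      rw [Bool.eq_not]; exact fun h'' => h h''.symm
    rw [h']
    simp

/-- Acting with `A` on a single tensor factor does not increase the norm. -/
theorem sum_mul_mulVec_update_le {β : Type*} [Fintype β] [DecidableEq β] (A : Matrix β β ℝ)
    (i : ι) (a b : (ι → β) → ℝ) :
    ∑ x, a x * A.mulVec (fun u => b (update x i u)) (x i)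
      ≤ specNorm A * (√(∑ x, a x ^ 2) * √(∑ x, b x ^ 2)) := by
  let e := (Equiv.funSplitAt i β).symm
  have hsum : ∀ F : (ι → β) → ℝ, ∑ x, F x = ∑ r, ∑ u, F (e (u, r)) := fun F => by
    rw [← e.sum_comp, Fintype.sum_prod_type_right]
  have hi : ∀ u r, e (u, r) i = u := fun u r => by simp [e, Equiv.funSplitAt, Equiv.piSplitAt]
  have hu : ∀ u u' r, update (e (u, r)) i u' = e (u', r) := fun u u' r => by
    ext k
    by_cases h : k = i
    · subst h; simp [e, Equiv.funSplitAt, Equiv.piSplitAt]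
    · simp [e, Equiv.funSplitAt, Equiv.piSplitAt, h]
  simp only [hsum, hi, hu]
  calc _ ≤ ∑ r, specNorm A * (√(∑ u, a (e (u, r)) ^ 2) * √(∑ u, b (e (u, r)) ^ 2)) :=
        sum_le_sum fun r _ => sum_mul_mulVec_le A (fun u => a (e (u, r))) fun u => b (e (u, r))
    _ ≤ _ := by
      rw [← mul_sum]
      exact mul_le_mul_of_nonneg_left (Real.sum_sqrt_mul_sqrt_le _ (fun _ => by positivity)
        fun _ => by positivity) (specNorm_nonneg_s16 A)

theorem specSens_comp_le (f : (ι → Bool) → Bool) (g : (κ → Bool) → Bool) :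
    specSens (fun x : ι × κ → Bool => f fun i => g fun j => x (i, j))
      ≤ specSens f * specSens g := by
  refine specNorm_le_of_forall_bilin _ (mul_nonneg (specNorm_nonneg_s16 _) (specNorm_nonneg_s16 _))
    fun a b => ?_
  let e := Equiv.curry ι κ Bool
  let G : (ι → κ → Bool) → ι → Bool := fun x k => g (x k)
  let r : ((ι × κ → Bool) → ℝ) → (ι → Bool) → (ι → κ → Bool) → ℝ :=
    fun a z x => if G x = z then a (e.symm x) else 0
  let φ : ((ι × κ → Bool) → ℝ) → (ι → Bool) → ℝ := fun a z => √(∑ x, r a z x ^ 2)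
  have hφ : ∀ a, ∑ z, φ a z ^ 2 = ∑ x, a x ^ 2 := fun a => by
    have : ∀ z, φ a z ^ 2 = ∑ x, r a z x ^ 2 := fun z => Real.sq_sqrt (by positivity)
    simp only [this]
    rw [sum_comm, ← e.symm.sum_comp]
    refine sum_congr rfl fun x _ => ?_
    simp [r, ite_pow]
  have hM : ∀ x, (sensAdj fun x : ι × κ → Bool => f fun i => g fun j => x (i, j)).mulVec b
      (e.symm x) = ∑ i, if f (G x) ≠ f (update (G x) i (!G x i)) then
          (sensAdj g).mulVec (fun u => b (e.symm (update x i u))) (x i) else 0 := fun x =>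
    sensAdj_comp_mulVec f g (fun y => b (e.symm y)) (e.symm x)
  have hblock : ∀ i z, (∑ x, if G x = z then
        a (e.symm x) * (sensAdj g).mulVec (fun u => b (e.symm (update x i u))) (x i) else 0)
      ≤ specSens g * (φ a z * φ b (update z i (!z i))) := fun i z => by
    refine le_of_eq_of_le ?_ (sum_mul_mulVec_update_le (sensAdj g) i (r a z)
      (r b (update z i (!z i))))
    refine sum_congr rfl fun x _ => ?_
    by_cases hx : G x = z
    · subst hx
      simp only [r, if_true]
      congr 1
      refine sum_congr rfl fun u _ => ?_
      have := sensAdj_mul_apply_comp_update g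
        (fun z => if z = update (G x) i (!G x i) then b (e.symm (update x i u)) else 0) x i u
      refine Eq.trans ?_ this.symm
      simp [G]
    · simp [r, hx]
  calc ∑ x, a x * (sensAdj _).mulVec b x
      = ∑ z, ∑ i, if f z ≠ f (update z i (!z i)) then (∑ x, if G x = z then
        a (e.symm x) * (sensAdj g).mulVec (fun u => b (e.symm (update x i u))) (x i) else 0)
          else 0 := by
        rw [← e.symm.sum_comp]
        simp only [hM, mul_sum]
        rw [sum_comm, sum_comm (s := univ (α := ι → Bool))]
        refine sum_congr rfl fun i _ => ?_
        have hswap : ∀ (P : (ι → Bool) → Prop) [DecidablePred P] (T : (ι → κ → Bool) → ℝ),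
            ∑ z, (if P z then ∑ x, (if G x = z then T x else 0) else 0)
              = ∑ x, if P (G x) then T x else 0 := fun P _ T => by
          simp only [← sum_filter P, sum_comm (s := univ.filter P)]
          simp
        rw [hswap fun z => f z ≠ f (update z i (!z i))]
        simp only [mul_ite, mul_zero]
    _ ≤ ∑ z, ∑ i, if f z ≠ f (update z i (!z i)) then
          specSens g * (φ a z * φ b (update z i (!z i))) else 0 := by
        refine sum_le_sum fun z _ => sum_le_sum fun i _ => ?_
        split_ifs
        · exact hblock i z
        · exact le_rfl
    _ = specSens g * ∑ z, φ a z * (sensAdj f).mulVec (φ b) z := by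
        simp only [sensAdj_mulVec, mul_sum, mul_ite, mul_zero]
    _ ≤ specSens g * (specSens f * (√(∑ z, φ a z ^ 2) * √(∑ z, φ b z ^ 2))) :=
        mul_le_mul_of_nonneg_left (sum_mul_mulVec_le _ _ _) (specNorm_nonneg_s16 _)
    _ = _ := by rw [hφ, hφ]; ring

/-- An eigenvector for a nonzero eigenvalue has equal `ℓ2` mass on both fibres of `g`. -/
theorem sum_sq_fibre_eq_of_eigenvector (g : (κ → Bool) → Bool) {μ : ℝ} (hμ : μ ≠ 0)
    {v : (κ → Bool) → ℝ} (hv : (sensAdj g).mulVec v = μ • v) (p q : Bool) :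
    (∑ u, if g u = p then v u ^ 2 else 0) = ∑ u, if g u = q then v u ^ 2 else 0 := by
  have key : (∑ u, if g u = true then v u ^ 2 else 0) = ∑ u, if g u = false then v u ^ 2 else 0 := by
    refine mul_left_cancel₀ hμ ?_
    have hexp : ∀ p, μ * (∑ u, if g u = p then v u ^ 2 else 0)
        = ∑ u, ∑ u', if g u = p then v u * (sensAdj g u u' * v u') else 0 := fun p => by
      rw [mul_sum]
      refine sum_congr rfl fun u _ => ?_
      have hu : ∑ u', sensAdj g u u' * v u' = μ * v u := congrFun hv u
      by_cases h : g u = p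
      · simp only [h, if_true, ← mul_sum, hu]; ring
      · simp [h]
    rw [hexp, hexp, sum_comm]
    refine sum_congr rfl fun u _ => sum_congr rfl fun u' _ => ?_
    rw [(sensAdj_isSymm g).apply u u']
    by_cases h : g u = g u'
    · simp [sensAdj_eq_zero_of_eq h]
    · cases hu : g u <;> cases hu' : g u' <;> simp_all <;> ring
  cases p <;> cases q <;> simp only [key]

theorem le_specSens_comp (f : (ι → Bool) → Bool) (g : (κ → Bool) → Bool) :
    specSens f * specSens g
      ≤ specSens (fun x : ι × κ → Bool => f fun i => g fun j => x (i, j)) := by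
  obtain ⟨μ, v, hμ, hv0, hv⟩ := exists_eigenvector_abs_eq_specNorm _ (sensAdj_isSymm g)
  change |μ| = specSens g at hμ
  rw [← hμ]
  by_cases hμ0 : μ = 0
  · rw [hμ0, abs_zero, mul_zero]; exact specNorm_nonneg_s16 _
  let e := Equiv.curry ι κ Bool
  let G : (ι → κ → Bool) → ι → Bool := fun x k => g (x k)
  let Φ : ((ι → Bool) → ℝ) → (ι → κ → Bool) → ℝ := fun w x => w (G x) * ∏ k, v (x k)
  set c := ∑ u, if g u = true then v u ^ 2 else 0 with hc
  have hcp : ∀ p, (∑ u, if g u = p then v u ^ 2 else 0) = c :=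
    fun p => sum_sq_fibre_eq_of_eigenvector g hμ0 hv p true
  have hcpos : 0 < c := by
    obtain ⟨u, hu⟩ := Function.ne_iff.1 hv0
    rw [← hcp (g u)]
    refine sum_pos' (fun u' _ => by positivity) ⟨u, mem_univ _, ?_⟩
    rw [if_pos rfl]
    exact sq_pos_of_ne_zero hu
  have hΦnorm : ∀ w, √(∑ x, Φ w (e x) ^ 2) = √(c ^ Fintype.card ι) * √(∑ z, w z ^ 2) := fun w => by
    rw [← Real.sqrt_mul (by positivity), e.sum_comp (fun x => Φ w x ^ 2), mul_sum]
    congr 1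
    have hprod : ∀ z : ι → Bool,
        c ^ Fintype.card ι = ∑ x : ι → κ → Bool, if G x = z then (∏ k, v (x k)) ^ 2 else 0 :=
      fun z => by
        have : c ^ Fintype.card ι = ∏ k, ∑ u, if g u = z k then v u ^ 2 else 0 := by
          simp [hcp]
        rw [this, Fintype.prod_sum]
        refine sum_congr rfl fun x _ => ?_
        rw [Fintype.prod_ite_zero, ← prod_pow]
        simp only [G, funext_iff]
    calc ∑ x, Φ w x ^ 2
        = ∑ x, ∑ z, if G x = z then (∏ k, v (x k)) ^ 2 * w z ^ 2 else 0 := by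
          refine sum_congr rfl fun x _ => ?_
          simp [Φ, mul_pow, mul_comm]
      _ = _ := by
          rw [sum_comm]
          refine sum_congr rfl fun z _ => ?_
          rw [hprod z, sum_mul]
          simp
  have hΦmul : ∀ w, (sensAdj fun x : ι × κ → Bool => f fun i => g fun j => x (i, j)).mulVec
      (fun y => Φ w (e y)) = fun y => Φ (μ • (sensAdj f).mulVec w) (e y) := fun w => by
    funext y
    refine (sensAdj_comp_mulVec f g (Φ w) y).trans ?_
    change _ = (μ * (sensAdj f).mulVec w (G (e y))) * ∏ k, v (e y k)
    rw [sensAdj_mulVec, mul_sum, sum_mul]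
    refine sum_congr rfl fun i _ => ?_
    change (if f (G (e y)) ≠ f (update (G (e y)) i (!G (e y) i)) then
      (sensAdj g).mulVec (fun u => Φ w (update (e y) i u)) (e y i) else 0) = _
    generalize e y = x
    split_ifs with h
    · have hvx : ∑ u, sensAdj g (x i) u * v u = μ * v (x i) := congrFun hv (x i)
      rw [← mul_prod_erase univ (fun k => v (x k)) (mem_univ i)]
      calc ∑ u, sensAdj g (x i) u * Φ w (update x i u)
          = ∑ u, sensAdj g (x i) u * v u
              * (w (update (G x) i (!G x i)) * ∏ k ∈ univ.erase i, v (x k)) := by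
            refine sum_congr rfl fun u _ => ?_
            have h1 := sensAdj_mul_apply_comp_update g w x i u
            have h2 : ∏ k, v (update x i u k) = v u * ∏ k ∈ univ.erase i, v (x k) := by
              rw [← mul_prod_erase univ _ (mem_univ i), update_self]
              congr 1
              refine prod_congr rfl fun k hk => ?_
              rw [update_of_ne (ne_of_mem_erase hk)]
            change _ * (w (fun k => g (update x i u k)) * _) = _
            rw [h2, ← mul_assoc, h1]
            ring
        _ = _ := by rw [← sum_mul, hvx]; ring
    · simp
  rw [mul_comm, ← le_div_iff₀' (abs_pos.2 hμ0)]
  refine specNorm_le_of_forall_sqrt _ (div_nonneg (specNorm_nonneg_s16 _) (abs_nonneg _)) fun w => ?_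
  have h := sqrt_sum_sq_mulVec_le
    (sensAdj fun x : ι × κ → Bool => f fun i => g fun j => x (i, j)) (fun y => Φ w (e y))
  rw [hΦmul, hΦnorm, hΦnorm, mul_left_comm] at h
  have h' := le_of_mul_le_mul_left h (by positivity)
  have hs : √(∑ z, (μ • (sensAdj f).mulVec w) z ^ 2)
      = |μ| * √(∑ z, (sensAdj f).mulVec w z ^ 2) := by
    simp only [Pi.smul_apply, smul_eq_mul, mul_pow]
    rw [← mul_sum, Real.sqrt_mul (sq_nonneg _), Real.sqrt_sq_eq_abs]
  rw [hs] at h'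
  rw [div_mul_eq_mul_div, le_div_iff₀' (abs_pos.2 hμ0)]
  exact h'

end Composition

/-- For total Boolean functions `f : {0,1}^n → {0,1}` and
`g : {0,1}^m → {0,1}`, the composed function `f ∘ g` on `{0,1}^{nm}` (whose input consists
of `n` blocks of `m` bits, `g` applied to each block and `f` to the results) satisfies
`λ(f ∘ g) = λ(f) · λ(g)`. -/
theorem specSens_comp (n m : ℕ) (hn : 1 ≤ n) (hm : 1 ≤ m)
    (f : (Fin n → Bool) → Bool) (g : (Fin m → Bool) → Bool) :
    specSens (fun x : Fin n × Fin m → Bool => f (fun i => g (fun j => x (i, j))))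
      = specSens f * specSens g := by
  exact le_antisymm (specSens_comp_le f g) (le_specSens_comp f g)
end

section
/- For every n ≥ 1 and every total Boolean function f : {0,1}^n → {0,1}, λ(f) ≤ √(s₀(f) · s₁(f)). -/
/-- Sensitivity of `f` at `x`. -/
def sensAt {I : Type*} [Fintype I] [DecidableEq I] (f : (I → Bool) → Bool) (x : I → Bool) : ℕ :=
  (Finset.univ.filter fun i => f x ≠ f (Function.update x i (!x i))).card

/-- Neighbours of `x` in the sensitivity graph of `f`. -/
def sensNeighbors {I : Type*} [Fintype I] [DecidableEq I] (f : (I → Bool) → Bool) (x : I → Bool) :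
    Finset (I → Bool) :=
  Finset.univ.filter fun y => hammingDist x y = 1 ∧ f x ≠ f y

lemma mem_sensNeighbors {I : Type*} [Fintype I] [DecidableEq I] {f : (I → Bool) → Bool}
    {x y : I → Bool} : y ∈ sensNeighbors f x ↔ hammingDist x y = 1 ∧ f x ≠ f y := by
  simp [sensNeighbors]

lemma mem_sensNeighbors_comm {I : Type*} [Fintype I] [DecidableEq I] {f : (I → Bool) → Bool}
    {x y : I → Bool} : y ∈ sensNeighbors f x ↔ x ∈ sensNeighbors f y := by
  rw [mem_sensNeighbors, mem_sensNeighbors, hammingDist_comm, ne_comm]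

lemma eq_update_not_of_hammingDist_eq_one {I : Type*} [Fintype I] [DecidableEq I]
    {x y : I → Bool} (h : hammingDist x y = 1) : ∃ i, Function.update x i (!x i) = y := by
  obtain ⟨i, hi⟩ := Finset.card_eq_one.mp h
  refine ⟨i, funext fun j => ?_⟩
  have hj : x j ≠ y j ↔ j = i := by
    simpa using Finset.ext_iff.mp hi j
  by_cases hji : j = i
  · subst hji
    have := hj.mpr rfl
    cases hx : x j <;> cases hy : y j <;> simp_all
  · rw [Function.update_of_ne hji]
    exact not_not.mp (mt hj.mp hji)

lemma card_sensNeighbors_le {I : Type*} [Fintype I] [DecidableEq I] (f : (I → Bool) → Bool)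
    (x : I → Bool) : (sensNeighbors f x).card ≤ sensAt f x := by
  refine (Finset.card_le_card fun y hy => ?_).trans
    (Finset.card_image_le (f := fun i => Function.update x i (!x i)))
  obtain ⟨hd, hf⟩ := mem_sensNeighbors.mp hy
  obtain ⟨i, rfl⟩ := eq_update_not_of_hammingDist_eq_one hd
  exact Finset.mem_image_of_mem _ (by simpa using hf)

lemma sensAdj_mulVec_s17 {I : Type*} [Fintype I] [DecidableEq I] (f : (I → Bool) → Bool)
    (v : (I → Bool) → ℝ) (x : I → Bool) :
    (sensAdj f).mulVec v x = ∑ y ∈ sensNeighbors f x, v y := by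
  simp [Matrix.mulVec, dotProduct, sensAdj, sensNeighbors, Finset.sum_filter]

/-- If the sensitivity of `f` is at most `a` on `f⁻¹(0)` and at most `b` on `f⁻¹(1)`, then the
squared norm grows by a factor of at most `a * b` under the adjacency matrix. -/
lemma sum_sq_sensAdj_mulVec_le {I : Type*} [Fintype I] [DecidableEq I] (f : (I → Bool) → Bool)
    {a b : ℕ} (ha : ∀ x, f x = false → sensAt f x ≤ a) (hb : ∀ x, f x = true → sensAt f x ≤ b)
    (v : (I → Bool) → ℝ) :
    ∑ x, (sensAdj f).mulVec v x ^ 2 ≤ a * b * ∑ x, v x ^ 2 := by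
  have key (y : I → Bool) :
      ∑ x ∈ sensNeighbors f y, (sensNeighbors f x).card ≤ a * b := by
    have hy := card_sensNeighbors_le f y
    cases hfy : f y
    · refine (Finset.sum_le_card_nsmul _ _ b fun x hx => ?_).trans
        (Nat.mul_le_mul_right _ (hy.trans (ha y hfy)))
      have := (mem_sensNeighbors.mp hx).2
      exact (card_sensNeighbors_le f x).trans (hb x (by simpa [hfy] using this.symm))
    · refine (Finset.sum_le_card_nsmul _ _ a fun x hx => ?_).trans
        ((Nat.mul_le_mul_right _ (hy.trans (hb y hfy))).trans_eq (mul_comm _ _))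
      have := (mem_sensNeighbors.mp hx).2
      exact (card_sensNeighbors_le f x).trans (ha x (by simpa [hfy] using this.symm))
  calc ∑ x, (sensAdj f).mulVec v x ^ 2
      ≤ ∑ x, ∑ y ∈ sensNeighbors f x, ((sensNeighbors f x).card : ℝ) * v y ^ 2 := by
        refine Finset.sum_le_sum fun x _ => ?_
        rw [sensAdj_mulVec_s17, ← Finset.mul_sum]
        exact sq_sum_le_card_mul_sum_sq
    _ = ∑ y, ∑ x ∈ sensNeighbors f y, ((sensNeighbors f x).card : ℝ) * v y ^ 2 :=
        Finset.sum_comm' fun x y => by simp [mem_sensNeighbors_comm (x := x)]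
    _ ≤ ∑ y, (a * b : ℝ) * v y ^ 2 := by
        refine Finset.sum_le_sum fun y _ => ?_
        rw [← Finset.sum_mul]
        exact mul_le_mul_of_nonneg_right (mod_cast key y) (sq_nonneg _)
    _ = a * b * ∑ x, v x ^ 2 := by rw [Finset.mul_sum]

/-- `λ(f) ≤ √(s₀(f)·s₁(f))`. -/
theorem specSens_le_sqrt_sens0_sens1 (n : ℕ) (hn : 1 ≤ n) (f : (Fin n → Bool) → Bool) :
    specSens f ≤
      Real.sqrt
        (((Finset.univ.filter fun x : Fin n → Bool => f x = false).sup fun x => sensAt f x) *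
         ((Finset.univ.filter fun x : Fin n → Bool => f x = true).sup fun x => sensAt f x)) := by
  have hs (c : Bool) (x : Fin n → Bool) (hx : f x = c) :
      sensAt f x ≤ (Finset.univ.filter fun x => f x = c).sup fun x => sensAt f x :=
    Finset.le_sup (f := fun x => sensAt f x) (by simpa using hx)
  refine ContinuousLinearMap.opNorm_le_bound _ (Real.sqrt_nonneg _) fun v => ?_
  rw [EuclideanSpace.norm_eq, EuclideanSpace.norm_eq, ← Real.sqrt_mul (by positivity)]
  refine Real.sqrt_le_sqrt ?_
  simpa using sum_sq_sensAdj_mulVec_le f (hs false) (hs true) v.ofLp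
end
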